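/- arXiv:1409.7059 — 5 statements merged into one kernel-verified Lean document; each statement's English description precedes it below -/
import Mathlib

section
/- The following two statements are equivalent: (i) [Jacobian conjecture] for all polynomials P, Q ∈ ℂ[x,y], if the Jacobian determinant D(P,Q) vanishes nowhere on ℂ², then the polynomial map z ↦ (P(z), Q(z)) from ℂ² to ℂ² is injective; (ii) for all polynomials P, Q ∈ ℂ[x,y], if D(P,Q) vanishes nowhere on ℂ², then the singular set Sing(ω) = {z ∈ ℂ² : P(z)·(∂Q/∂x)(z) − Q(z)·(∂P/∂x)(z) = 0 and P(z)·(∂Q/∂y)(z) − Q(z)·(∂P/∂y)(z) = 0} of the 1-form ω = P dQ − Q dP has at most one point (is a subsingleton). -/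
open MvPolynomial

/-- The Jacobian determinant `D(F,G) = F_x G_y - F_y G_x` of two polynomials in two
variables, using formal partial derivatives. -/
noncomputable def jacDet (F G : MvPolynomial (Fin 2) ℂ) : MvPolynomial (Fin 2) ℂ :=
  pderiv 0 F * pderiv 1 G - pderiv 1 F * pderiv 0 G

theorem jacDet_sub_C (P Q : MvPolynomial (Fin 2) ℂ) (a b : ℂ) :
    jacDet (P - C a) (Q - C b) = jacDet P Q := by
  simp [jacDet]

/-- Where the Jacobian determinant does not vanish, the singular points of `P dQ - Q dP` are
exactly the common zeros of `P` and `Q`. -/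
theorem sing_iff_eval_eq_zero {P Q : MvPolynomial (Fin 2) ℂ} {z : Fin 2 → ℂ}
    (hD : eval z (jacDet P Q) ≠ 0) :
    (eval z P * eval z (pderiv 0 Q) - eval z Q * eval z (pderiv 0 P) = 0 ∧
      eval z P * eval z (pderiv 1 Q) - eval z Q * eval z (pderiv 1 P) = 0) ↔
    eval z P = 0 ∧ eval z Q = 0 := by
  refine ⟨fun ⟨h0, h1⟩ => ?_, fun ⟨hP, hQ⟩ => by simp [hP, hQ]⟩
  have hDet : eval z (jacDet P Q) = eval z (pderiv 0 P) * eval z (pderiv 1 Q) -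
      eval z (pderiv 1 P) * eval z (pderiv 0 Q) := by
    simp [jacDet]
  constructor <;> refine (mul_eq_zero.mp ?_).resolve_right hD <;> rw [hDet]
  · linear_combination eval z (pderiv 0 P) * h1 - eval z (pderiv 1 P) * h0
  · linear_combination eval z (pderiv 0 Q) * h1 - eval z (pderiv 1 Q) * h0

/-- The Jacobian conjecture is equivalent to the statement that for every pair `(P,Q)`
with nowhere-vanishing Jacobian determinant, the 1-form `ω = P dQ - Q dP` has at most
one singular point. -/
theorem jacobian_conjecture_iff_sing_subsingleton :
    (∀ P Q : MvPolynomial (Fin 2) ℂ,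
        (∀ z : Fin 2 → ℂ, eval z (jacDet P Q) ≠ 0) →
        Function.Injective (fun z : Fin 2 → ℂ => (eval z P, eval z Q))) ↔
    (∀ P Q : MvPolynomial (Fin 2) ℂ,
        (∀ z : Fin 2 → ℂ, eval z (jacDet P Q) ≠ 0) →
        ({z : Fin 2 → ℂ |
            eval z P * eval z (pderiv 0 Q) - eval z Q * eval z (pderiv 0 P) = 0 ∧
            eval z P * eval z (pderiv 1 Q) - eval z Q * eval z (pderiv 1 P) = 0} :
          Set (Fin 2 → ℂ)).Subsingleton) := by
  constructor
  · intro h P Q hD z hz w hw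
    obtain ⟨hPz, hQz⟩ := (sing_iff_eval_eq_zero (hD z)).mp hz
    obtain ⟨hPw, hQw⟩ := (sing_iff_eval_eq_zero (hD w)).mp hw
    exact h P Q hD (by simp [hPz, hQz, hPw, hQw])
  · intro h P Q hD z w hzw
    obtain ⟨hP, hQ⟩ := Prod.mk.inj hzw
    have hD' (u : Fin 2 → ℂ) :
        eval u (jacDet (P - C (eval w P)) (Q - C (eval w Q))) ≠ 0 := by
      rw [jacDet_sub_C]
      exact hD u
    exact h _ _ hD' ((sing_iff_eval_eq_zero (hD' z)).mpr (by simp [hP, hQ]))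
      ((sing_iff_eval_eq_zero (hD' w)).mpr (by simp))
end

section
/- Let H, J ∈ ℂ[x,y] be homogeneous polynomials of degrees k and l respectively. If D(H,J) = 0, then k·H·(∂J/∂v) = l·J·(∂H/∂v) for each variable v ∈ {x,y}; that is, k H dJ − l J dH = 0. -/
open MvPolynomial

/-- For homogeneous `H, J` of degrees `k, l`, if `D(H,J) = 0` then
`k H dJ - l J dH = 0`, i.e. `k·H·∂J/∂v = l·J·∂H/∂v` for each variable `v`. -/
theorem euler_relation_of_jacDet_eq_zero (H J : MvPolynomial (Fin 2) ℂ) (k l : ℕ)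
    (hH : H.IsHomogeneous k) (hJ : J.IsHomogeneous l)
    (hD : jacDet H J = 0) :
    ∀ v : Fin 2,
      (k : MvPolynomial (Fin 2) ℂ) * H * pderiv v J
        - (l : MvPolynomial (Fin 2) ℂ) * J * pderiv v H = 0 := by
  have eH := hH.sum_X_mul_pderiv
  have eJ := hJ.sum_X_mul_pderiv
  rw [Fin.sum_univ_two, nsmul_eq_mul] at eH eJ
  unfold jacDet at hD
  rw [Fin.forall_fin_two]
  constructor
  · linear_combination pderiv 0 H * eJ - pderiv 0 J * eH - X 1 * hD
  · linear_combination pderiv 1 H * eJ - pderiv 1 J * eH + X 0 * hD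
end

section
/- Let H, J ∈ ℂ[x,y] be homogeneous polynomials of degrees k and l respectively, with H ≠ 0. Then D(H,J) = 0 if and only if there exists λ ∈ ℂ such that J^k = λ·H^l. -/
open MvPolynomial

theorem coeff_X_mul_pderiv {σ R : Type*} [CommSemiring R] (p : MvPolynomial σ R) (i : σ)
    (m : σ →₀ ℕ) : coeff m (X i * pderiv i p) = m i * coeff m p := by
  classical
  induction p using MvPolynomial.induction_on' with
  | monomial n a =>
    rw [X_mul_pderiv_monomial, coeff_smul, coeff_monomial, nsmul_eq_mul]
    split_ifs with h
    · rw [h]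
    · simp
  | add p q hp hq => rw [map_add, mul_add, coeff_add, hp, hq, coeff_add, mul_add]

theorem MonomialOrder.degree_X_mul_pderiv_le {σ R : Type*} [CommSemiring R] (ord : MonomialOrder σ)
    (p : MvPolynomial σ R) (i : σ) :
    ord.toSyn (ord.degree (X i * pderiv i p)) ≤ ord.toSyn (ord.degree p) := by
  rw [ord.degree_le_iff]
  intro b hb
  apply ord.le_degree
  rw [mem_support_iff, coeff_X_mul_pderiv] at hb
  exact mem_support_iff.2 (right_ne_zero_of_mul hb)

/-- In characteristic zero, polynomials with equal logarithmic derivatives have the same degree with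
respect to every monomial order. -/
theorem MonomialOrder.degree_eq_of_mul_pderiv_eq {σ R : Type*} [CommRing R] [IsDomain R]
    [CharZero R] (ord : MonomialOrder σ) {p q : MvPolynomial σ R} (hp : p ≠ 0) (hq : q ≠ 0)
    (h : ∀ i, p * pderiv i q = q * pderiv i p) : ord.degree p = ord.degree q := by
  ext i
  have h₁ : p * (X i * pderiv i q) = q * (X i * pderiv i p) := by
    linear_combination X i * h i
  have h₂ := congrArg (coeff (ord.degree p + ord.degree q)) h₁
  rw [ord.coeff_mul_of_add_of_degree_le le_rfl (ord.degree_X_mul_pderiv_le q i),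
    add_comm (ord.degree p),
    ord.coeff_mul_of_add_of_degree_le le_rfl (ord.degree_X_mul_pderiv_le p i),
    coeff_X_mul_pderiv, coeff_X_mul_pderiv] at h₂
  have hp' := (ord.coeff_degree_ne_zero_iff).2 hp
  have hq' := (ord.coeff_degree_ne_zero_iff).2 hq
  have h₃ : ((ord.degree p i : R) - ord.degree q i) *
      (coeff (ord.degree p) p * coeff (ord.degree q) q) = 0 := by
    linear_combination -h₂
  exact_mod_cast sub_eq_zero.1
    ((mul_eq_zero.1 h₃).resolve_right (mul_ne_zero hp' hq'))

/-- Over a field of characteristic zero, polynomials with equal logarithmic derivatives are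
proportional. -/
theorem exists_eq_C_mul_of_mul_pderiv_eq {σ K : Type*} [Field K] [CharZero K]
    (ord : MonomialOrder σ) {p q : MvPolynomial σ K} (hp : p ≠ 0)
    (h : ∀ i, p * pderiv i q = q * pderiv i p) : ∃ c : K, q = C c * p := by
  have hp' := (ord.coeff_degree_ne_zero_iff).2 hp
  set c := coeff (ord.degree p) q / coeff (ord.degree p) p with hc
  refine ⟨c, ?_⟩
  by_contra hne
  have hr : q - C c * p ≠ 0 := sub_ne_zero.2 hne
  have hdeg := ord.degree_eq_of_mul_pderiv_eq hp hr fun i ↦ by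
    rw [map_sub, pderiv_C_mul]
    linear_combination h i
  apply (ord.coeff_degree_ne_zero_iff).2 hr
  rw [← hdeg, coeff_sub, coeff_C_mul, hc, div_mul_cancel₀ _ hp', sub_self]

theorem jacDet_pow_left (F G : MvPolynomial (Fin 2) ℂ) (n : ℕ) :
    jacDet (F ^ n) G = n * F ^ (n - 1) * jacDet F G := by
  simp only [jacDet, pderiv_pow]
  ring

theorem jacDet_pow_right (F G : MvPolynomial (Fin 2) ℂ) (n : ℕ) :
    jacDet F (G ^ n) = n * G ^ (n - 1) * jacDet F G := by
  simp only [jacDet, pderiv_pow]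
  ring

theorem jacDet_C_mul_self_pow (F : MvPolynomial (Fin 2) ℂ) (c : ℂ) (n : ℕ) :
    jacDet F (C c * F ^ n) = 0 := by
  simp only [jacDet, pderiv_C_mul, pderiv_pow]
  ring

/-- Homogeneous polynomials of the same degree with vanishing Jacobian determinant are
proportional. -/
theorem exists_eq_C_mul_of_jacDet_eq_zero {F G : MvPolynomial (Fin 2) ℂ} {n : ℕ}
    (hF : F.IsHomogeneous n) (hG : G.IsHomogeneous n) (hF0 : F ≠ 0) (h : jacDet F G = 0) :
    ∃ c : ℂ, G = C c * F := by
  refine exists_eq_C_mul_of_mul_pderiv_eq MonomialOrder.lex hF0 ?_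
  rcases Nat.eq_zero_or_pos n with rfl | hn
  · intro i
    rw [totalDegree_eq_zero_iff_eq_C.1 ((totalDegree_zero_iff_isHomogeneous _).2 hF),
      totalDegree_eq_zero_iff_eq_C.1 ((totalDegree_zero_iff_isHomogeneous _).2 hG)]
    simp
  · have hn' : (n : MvPolynomial (Fin 2) ℂ) ≠ 0 := Nat.cast_ne_zero.2 hn.ne'
    have eF := hF.sum_X_mul_pderiv
    have eG := hG.sum_X_mul_pderiv
    rw [Fin.sum_univ_two, nsmul_eq_mul] at eF eG
    rw [jacDet] at h
    refine Fin.forall_fin_two.2 ⟨mul_left_cancel₀ hn' ?_, mul_left_cancel₀ hn' ?_⟩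
    · linear_combination pderiv 0 F * eG - pderiv 0 G * eF - X 1 * h
    · linear_combination pderiv 1 F * eG - pderiv 1 G * eF + X 0 * h

/-- For homogeneous `H, J` of degrees `k, l` with `H ≠ 0`, the Jacobian determinant
`D(H,J)` vanishes if and only if `J^k = λ·H^l` for some constant `λ ∈ ℂ`. -/
theorem jacDet_eq_zero_iff_proportional_powers (H J : MvPolynomial (Fin 2) ℂ) (k l : ℕ)
    (hH : H.IsHomogeneous k) (hJ : J.IsHomogeneous l) (hH0 : H ≠ 0) :
    jacDet H J = 0 ↔ ∃ lam : ℂ, J ^ k = C lam * H ^ l := by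
  constructor
  · intro h
    refine exists_eq_C_mul_of_jacDet_eq_zero (hH.pow l) (mul_comm l k ▸ hJ.pow k)
      (pow_ne_zero l hH0) ?_
    rw [jacDet_pow_left, jacDet_pow_right, h, mul_zero, mul_zero]
  · rintro ⟨c, hc⟩
    rcases Nat.eq_zero_or_pos k with rfl | hk
    · rw [totalDegree_eq_zero_iff_eq_C.1 ((totalDegree_zero_iff_isHomogeneous _).2 hH)]
      simp [jacDet]
    · have hzero := jacDet_C_mul_self_pow H c l
      rw [← hc, jacDet_pow_right] at hzero
      rcases mul_eq_zero.1 hzero with h | h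
      · have hJ0 : J = 0 := eq_zero_of_pow_eq_zero
          ((mul_eq_zero.1 h).resolve_left (Nat.cast_ne_zero.2 hk.ne'))
        simp [jacDet, hJ0]
      · exact h
end

section
/- Let P, Q ∈ ℂ[x,y] with P(0) = Q(0) = 0, deg P = k ≥ 1, deg Q = l ≥ 1, and k + l ≥ 3. If the Jacobian determinant D(P,Q) is a constant, then D(P_k, Q_l) = 0, and consequently there exists λ ∈ ℂ such that Q_l^k = λ·P_k^l, where P_k and Q_l are the top-degree homogeneous components of P and Q. -/
open MvPolynomial

theorem MvPolynomial.homogeneousComponent_pderiv {σ R : Type*} [CommSemiring R] (i : σ)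
    (P : MvPolynomial σ R) (n : ℕ) :
    homogeneousComponent n (pderiv i P) = pderiv i (homogeneousComponent (n + 1) P) := by
  ext d
  simp [coeff_homogeneousComponent, coeff_pderiv]

theorem MvPolynomial.coeff_eq_zero_of_totalDegree_lt_degree {σ R : Type*} [CommSemiring R]
    {P : MvPolynomial σ R} {d : σ →₀ ℕ} (h : P.totalDegree < d.degree) : coeff d P = 0 :=
  coeff_eq_zero_of_totalDegree_lt h

theorem MvPolynomial.totalDegree_pderiv_le {σ R : Type*} [CommSemiring R] (i : σ)
    (P : MvPolynomial σ R) : (pderiv i P).totalDegree ≤ P.totalDegree - 1 := by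
  refine Finset.sup_le fun d hd => ?_
  rw [mem_support_iff, coeff_pderiv] at hd
  have h : (d + Finsupp.single i 1).degree ≤ P.totalDegree := by
    by_contra! h
    exact hd (by rw [coeff_eq_zero_of_totalDegree_lt_degree h, zero_mul])
  rw [map_add, Finsupp.degree_single] at h
  change d.degree ≤ _
  omega

theorem MvPolynomial.homogeneousComponent_add_mul {σ R : Type*} [CommSemiring R]
    {A B : MvPolynomial σ R} {m n : ℕ} (hA : A.totalDegree ≤ m) (hB : B.totalDegree ≤ n) :
    homogeneousComponent (m + n) (A * B) =
      homogeneousComponent m A * homogeneousComponent n B := by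
  classical
  ext d
  rw [coeff_homogeneousComponent]
  split_ifs with hd
  · rw [coeff_mul, coeff_mul]
    refine Finset.sum_congr rfl fun x hx => ?_
    rw [← Finset.HasAntidiagonal.mem_antidiagonal.mp hx, map_add] at hd
    rw [coeff_homogeneousComponent, coeff_homogeneousComponent]
    rcases lt_trichotomy x.1.degree m with h | h | h
    · rw [coeff_eq_zero_of_totalDegree_lt_degree (P := B) (d := x.2) (by omega)]
      simp
    · rw [if_pos h, if_pos (by omega)]
    · rw [coeff_eq_zero_of_totalDegree_lt_degree (P := A) (d := x.1) (by omega)]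
      simp
  · exact (((homogeneousComponent_isHomogeneous m A).mul
      (homogeneousComponent_isHomogeneous n B)).coeff_eq_zero hd).symm

theorem MvPolynomial.homogeneousComponent_totalDegree_ne_zero {σ R : Type*} [CommSemiring R]
    {P : MvPolynomial σ R} (hP : P ≠ 0) : homogeneousComponent P.totalDegree P ≠ 0 := by
  obtain ⟨d, hd, h⟩ := Finset.exists_mem_eq_sup P.support (support_nonempty.mpr hP)
    fun s => s.sum fun _ e => e
  intro h0
  have h1 := congrArg (coeff d) h0
  have hdeg : d.degree = P.totalDegree := h.symm
  rw [coeff_homogeneousComponent, if_pos hdeg, coeff_zero] at h1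
  exact mem_support_iff.mp hd h1

theorem MvPolynomial.eq_C_of_pderiv_eq_zero {σ R : Type*} [CommRing R] [IsDomain R] [CharZero R]
    {P : MvPolynomial σ R} (h : ∀ i, pderiv i P = 0) : P = C (coeff 0 P) := by
  classical
  ext d
  rw [coeff_C]
  split_ifs with hd
  · rw [hd]
  · obtain ⟨i, hi⟩ := Finsupp.ne_iff.mp (Ne.symm hd)
    have hi' : Finsupp.single i 1 ≤ d := by
      simpa [Nat.one_le_iff_ne_zero] using hi
    have h1 := congrArg (coeff (d - Finsupp.single i 1)) (h i)
    rw [coeff_pderiv, tsub_add_cancel_of_le hi', coeff_zero] at h1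
    exact (mul_eq_zero.mp h1).resolve_right (Nat.cast_add_one_ne_zero _)

theorem MvPolynomial.pderiv_eq_zero_of_dvd {σ R : Type*} [CommRing R] [IsDomain R]
    {P : MvPolynomial σ R} {i : σ} (h : P ∣ pderiv i P) : pderiv i P = 0 := by
  by_contra h0
  have h1 := totalDegree_le_of_dvd_of_isDomain h h0
  have h2 := totalDegree_pderiv_le i P
  have h3 : P.totalDegree = 0 := by omega
  rw [totalDegree_eq_zero_iff_eq_C.mp h3, pderiv_C] at h0
  exact h0 rfl

/-- Two polynomials over a field of characteristic zero with vanishing Wronskians are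
proportional. -/
theorem MvPolynomial.exists_eq_C_mul_of_pderiv_mul_eq {σ K : Type*} [Field K] [CharZero K]
    {A B : MvPolynomial σ K} (hB : B ≠ 0) (h : ∀ i, pderiv i A * B = A * pderiv i B) :
    ∃ c : K, A = C c * B := by
  obtain ⟨b, a, g, hrel, rfl, rfl⟩ := UniqueFactorizationMonoid.exists_reduced_factors B hB A
  have hg : g ≠ 0 := by
    rintro rfl
    simp at hB
  have hb : b ≠ 0 := by
    rintro rfl
    simp at hB
  have hrel : IsRelPrime b a := hrel
  have hab : ∀ i, pderiv i a * b = a * pderiv i b := by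
    intro i
    have hi := h i
    rw [pderiv_mul, pderiv_mul] at hi
    refine mul_left_cancel₀ (pow_ne_zero 2 hg) ?_
    linear_combination hi
  have hb' : ∀ i, pderiv i b = 0 := fun i =>
    pderiv_eq_zero_of_dvd (hrel.dvd_of_dvd_mul_left (Dvd.intro_left _ (hab i)))
  have ha' : ∀ i, pderiv i a = 0 := by
    intro i
    have hi := hab i
    rw [hb' i, mul_zero] at hi
    exact (mul_eq_zero.mp hi).resolve_right hb
  obtain ⟨s, rfl⟩ : ∃ s, a = C s := ⟨_, eq_C_of_pderiv_eq_zero ha'⟩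
  obtain ⟨t, rfl⟩ : ∃ t, b = C t := ⟨_, eq_C_of_pderiv_eq_zero hb'⟩
  have ht : t ≠ 0 := by
    rintro rfl
    simp at hb
  refine ⟨s / t, ?_⟩
  rw [mul_left_comm, ← C_mul, div_mul_cancel₀ s ht]

theorem homogeneousComponent_jacDet {P Q : MvPolynomial (Fin 2) ℂ} {m n : ℕ}
    (hP : P.totalDegree ≤ m + 1) (hQ : Q.totalDegree ≤ n + 1) :
    homogeneousComponent (m + n) (jacDet P Q) =
      jacDet (homogeneousComponent (m + 1) P) (homogeneousComponent (n + 1) Q) := by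
  have hP' (i : Fin 2) : (pderiv i P).totalDegree ≤ m :=
    (totalDegree_pderiv_le i P).trans (by omega)
  have hQ' (i : Fin 2) : (pderiv i Q).totalDegree ≤ n :=
    (totalDegree_pderiv_le i Q).trans (by omega)
  simp only [jacDet, map_sub, homogeneousComponent_add_mul (hP' _) (hQ' _),
    homogeneousComponent_pderiv]

/-- Homogeneous bivariate polynomials with vanishing Jacobian determinant have proportional
logarithmic derivatives. -/
theorem MvPolynomial.IsHomogeneous.mul_pderiv_eq_of_jacDet_eq_zero
    {p q : MvPolynomial (Fin 2) ℂ} {k l : ℕ} (hp : p.IsHomogeneous k) (hq : q.IsHomogeneous l)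
    (h : jacDet p q = 0) (i : Fin 2) :
    (k : MvPolynomial (Fin 2) ℂ) * p * pderiv i q = l * q * pderiv i p := by
  have ep := hp.sum_X_mul_pderiv
  have eq := hq.sum_X_mul_pderiv
  rw [Fin.sum_univ_two, nsmul_eq_mul] at ep eq
  rw [jacDet] at h
  rw [← ep, ← eq]
  revert i
  rw [Fin.forall_fin_two]
  constructor
  · linear_combination -(X 1) * h
  · linear_combination X 0 * h

/-- If `P, Q` vanish at the origin, have degrees `k, l ≥ 1` with `k + l ≥ 3`, and
`D(P,Q)` is constant, then `D(P_k, Q_l) = 0` and there is `λ ∈ ℂ` with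
`Q_l^k = λ·P_k^l`. -/
theorem top_components_proportional (P Q : MvPolynomial (Fin 2) ℂ) (k l : ℕ)
    (hP0 : eval (0 : Fin 2 → ℂ) P = 0) (hQ0 : eval (0 : Fin 2 → ℂ) Q = 0)
    (hdegP : P.totalDegree = k) (hdegQ : Q.totalDegree = l)
    (hk : 1 ≤ k) (hl : 1 ≤ l) (hkl : 3 ≤ k + l)
    (hconst : ∃ c : ℂ, jacDet P Q = C c) :
    jacDet (homogeneousComponent k P) (homogeneousComponent l Q) = 0 ∧
    ∃ lam : ℂ,
      (homogeneousComponent l Q) ^ k = C lam * (homogeneousComponent k P) ^ l := by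
  have hjac : jacDet (homogeneousComponent k P) (homogeneousComponent l Q) = 0 := by
    obtain ⟨c, hc⟩ := hconst
    obtain ⟨m, rfl⟩ : ∃ m, k = m + 1 := ⟨k - 1, by omega⟩
    obtain ⟨n, rfl⟩ : ∃ n, l = n + 1 := ⟨l - 1, by omega⟩
    rw [← homogeneousComponent_jacDet hdegP.le hdegQ.le, hc]
    refine homogeneousComponent_eq_zero _ _ ?_
    rw [totalDegree_C]
    omega
  refine ⟨hjac, exists_eq_C_mul_of_pderiv_mul_eq (pow_ne_zero l ?_) fun i => ?_⟩
  · rw [← hdegP]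
    refine homogeneousComponent_totalDegree_ne_zero ?_
    rintro rfl
    rw [totalDegree_zero] at hdegP
    omega
  · have hi := (homogeneousComponent_isHomogeneous k P).mul_pderiv_eq_of_jacDet_eq_zero
      (homogeneousComponent_isHomogeneous l Q) hjac i
    generalize homogeneousComponent k P = p at hi ⊢
    generalize homogeneousComponent l Q = q at hi ⊢
    rw [pderiv_pow, pderiv_pow]
    obtain ⟨m, rfl⟩ : ∃ m, k = m + 1 := ⟨k - 1, by omega⟩
    obtain ⟨n, rfl⟩ : ∃ n, l = n + 1 := ⟨l - 1, by omega⟩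
    simp only [Nat.add_sub_cancel]
    linear_combination q ^ m * p ^ n * hi
end

section
/- [Statement 1] Let s ≥ 1 be an integer, let j ≥ 1 be an integer, let G ∈ ℂ[x,y] be a nonzero polynomial, let R_1, R_2, R_3, … ∈ ℂ[x,y] be polynomials, let λ_0, …, λ_{j−1} ∈ ℂ, and let t_0, …, t_{j−1} ∈ ℚ be such that s_r := s·t_r is an integer for each r. Then, in the fraction field of ℂ[x,y], Σ_{j'=0}^{j−1} Σ_{r=0}^{j'} Σ_{α ∈ Γ, σ(α) = j'−r} λ_r · C(t_r, α) · G^{s_r − s|α|} · D(R_{j−j'}, R^α) = 0, where R^α = ∏_{i≥1} R_i^{α_i}, the integer powers of G are taken in the fraction field, and D(·,·) of the polynomial arguments is mapped into the fraction field. -/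
open MvPolynomial

/-- The fraction field of `ℂ[x,y]`. -/
abbrev FF : Type := FractionRing (MvPolynomial (Fin 2) ℂ)

/-- The modulus `|α| = Σ_i α_i`. -/
def msize (a : ℕ+ →₀ ℕ) : ℕ := a.sum fun _ n => n

/-- The size `σ(α) = Σ_i i·α_i`. -/
def ssize (a : ℕ+ →₀ ℕ) : ℕ := a.sum fun i n => (i : ℕ) * n

/-- `α! = Π_i (α_i)!`. -/
def gfact (a : ℕ+ →₀ ℕ) : ℕ := a.prod fun _ n => n.factorial

/-- The generalized multinomial coefficient `C(t, α) = (t)_{|α|} / α!`, where `(t)_m`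
is the falling factorial. -/
noncomputable def mcoeff (t : ℚ) (a : ℕ+ →₀ ℕ) : ℚ :=
  Polynomial.eval t (descPochhammer ℚ (msize a)) / (gfact a : ℚ)

/-- `R^α = Π_{i ≥ 1} R_i^{α_i}`. -/
noncomputable def Rpow (R : ℕ → MvPolynomial (Fin 2) ℂ) (a : ℕ+ →₀ ℕ) :
    MvPolynomial (Fin 2) ℂ :=
  a.prod fun i n => R (i : ℕ) ^ n

/-- The set of multi-indices of size less than `N` is finite. -/
theorem finite_ssize_lt (N : ℕ) : {a : ℕ+ →₀ ℕ | ssize a < N}.Finite := by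
  refine (Set.finite_Iic (∑ i ∈ Finset.range N, Finsupp.single (Nat.succPNat i) N)).subset ?_
  intro a ha i
  simp only [Set.mem_ofPred_eq] at ha
  by_cases hi : a i = 0
  · simp [hi]
  have h1 : (i : ℕ) * a i ≤ ssize a :=
    Finset.single_le_sum (f := fun i : ℕ+ => (i : ℕ) * a i) (fun _ _ => Nat.zero_le _)
      (Finsupp.mem_support_iff.mpr hi)
  have hpos := i.pos
  have h2 : a i ≤ (i : ℕ) * a i := Nat.le_mul_of_pos_left _ hpos
  have h3 : (i : ℕ) ≤ (i : ℕ) * a i := Nat.le_mul_of_pos_right _ (Nat.pos_of_ne_zero hi)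
  have h4 : (∑ k ∈ Finset.range N, Finsupp.single (Nat.succPNat k) N : ℕ+ →₀ ℕ) i ≥ N := by
    rw [Finsupp.finsetSum_apply]
    have hm : i.natPred ∈ Finset.range N := by
      have := PNat.natPred_add_one i
      simp only [Finset.mem_range]
      omega
    calc N = (Finsupp.single (Nat.succPNat i.natPred) N : ℕ+ →₀ ℕ) i := by simp
      _ ≤ _ := Finset.single_le_sum
        (f := fun k => (Finsupp.single (Nat.succPNat k) N : ℕ+ →₀ ℕ) i)
        (fun _ _ => Nat.zero_le _) hm
  omega

/-- Summing over multi-indices by size amounts to summing over all multi-indices of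
bounded size. -/
theorem sum_finsum_ssize {M : Type*} [AddCommMonoid M] (N : ℕ) (f : ℕ → (ℕ+ →₀ ℕ) → M) :
    ∑ k ∈ Finset.range N, ∑ᶠ a ∈ {a : ℕ+ →₀ ℕ | ssize a = k}, f k a =
      ∑ a ∈ (finite_ssize_lt N).toFinset, f (ssize a) a := by
  rw [← Finset.sum_fiberwise_of_maps_to (s := (finite_ssize_lt N).toFinset)
    (t := Finset.range N) (g := ssize) (by simp)]
  refine Finset.sum_congr rfl fun k hk => ?_
  have hset : {a : ℕ+ →₀ ℕ | ssize a = k} =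
      ↑((finite_ssize_lt N).toFinset.filter fun a => ssize a = k) := by
    ext a
    simp only [Finset.mem_range] at hk
    simp only [Set.mem_ofPred_eq, Finset.coe_filter, Set.Finite.mem_toFinset]
    omega
  rw [hset, finsum_mem_coe_finset]
  refine Finset.sum_congr rfl fun a ha => ?_
  rw [(Finset.mem_filter.mp ha).2]

theorem msize_add_single (b : ℕ+ →₀ ℕ) (i : ℕ+) :
    msize (b + Finsupp.single i 1) = msize b + 1 := by
  unfold msize
  rw [Finsupp.sum_add_index' (by simp) (by simp), Finsupp.sum_single_index rfl]

theorem ssize_add_single (b : ℕ+ →₀ ℕ) (i : ℕ+) :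
    ssize (b + Finsupp.single i 1) = ssize b + i := by
  unfold ssize
  rw [Finsupp.sum_add_index' (by simp) (by simp [mul_add]), Finsupp.sum_single_index (by simp),
    mul_one]

theorem gfact_add_single (b : ℕ+ →₀ ℕ) (i : ℕ+) :
    gfact (b + Finsupp.single i 1) = gfact b * (b i + 1) := by
  classical
  have hsub : b.support ⊆ insert i b.support := Finset.subset_insert _ _
  have hsub' : (b + Finsupp.single i 1).support ⊆ insert i b.support := by
    intro k hk
    by_contra h
    simp only [Finset.mem_insert, not_or, Finsupp.mem_support_iff, not_not] at h
    simp [h.2, Ne.symm h.1] at hk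
  unfold gfact
  rw [Finsupp.prod_of_support_subset _ hsub _ (by simp),
    Finsupp.prod_of_support_subset _ hsub' _ (by simp),
    ← Finset.mul_prod_erase _ _ (Finset.mem_insert_self i b.support),
    ← Finset.mul_prod_erase (insert i b.support) _ (Finset.mem_insert_self i b.support)]
  have : ∏ k ∈ (insert i b.support).erase i, ((b + Finsupp.single i 1 : ℕ+ →₀ ℕ) k).factorial =
      ∏ k ∈ (insert i b.support).erase i, (b k).factorial :=
    Finset.prod_congr rfl fun k hk => by
      simp [Ne.symm (Finset.ne_of_mem_erase hk)]
  rw [this]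
  simp only [Finsupp.add_apply, Finsupp.single_eq_same, Nat.factorial_succ]
  ring

/-- The product `α_i C(t, α)` with `α = β + e_i` depends on `β` only. -/
theorem mcoeff_add_single_mul (t : ℚ) (b : ℕ+ →₀ ℕ) (i : ℕ+) :
    mcoeff t (b + Finsupp.single i 1) * ((b + Finsupp.single i 1 : ℕ+ →₀ ℕ) i : ℚ) =
      Polynomial.eval t (descPochhammer ℚ (msize b + 1)) / (gfact b : ℚ) := by
  have hb : (gfact b : ℚ) ≠ 0 := by
    exact_mod_cast Finset.prod_ne_zero_iff.mpr fun k _ => Nat.factorial_ne_zero _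
  have hi : (b i : ℚ) + 1 ≠ 0 := by positivity
  unfold mcoeff
  rw [msize_add_single, gfact_add_single]
  simp only [Finsupp.add_apply, Finsupp.single_eq_same]
  push_cast
  field_simp

theorem Rpow_add_single (R : ℕ → MvPolynomial (Fin 2) ℂ) (b : ℕ+ →₀ ℕ) (i : ℕ+) :
    Rpow R (b + Finsupp.single i 1) = Rpow R b * R i := by
  unfold Rpow
  rw [Finsupp.prod_add_index' (by simp) (by simp [pow_add]),
    Finsupp.prod_single_index (by simp), pow_one]

theorem jacDet_self (F : MvPolynomial (Fin 2) ℂ) : jacDet F F = 0 := by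
  unfold jacDet
  ring

theorem jacDet_swap (F G : MvPolynomial (Fin 2) ℂ) : jacDet F G = -jacDet G F := by
  unfold jacDet
  ring

/-- `D(F, ·)` as a derivation. -/
noncomputable def jacDerivation (F : MvPolynomial (Fin 2) ℂ) :
    Derivation ℂ (MvPolynomial (Fin 2) ℂ) (MvPolynomial (Fin 2) ℂ) :=
  pderiv 0 F • pderiv 1 - pderiv 1 F • pderiv 0

theorem jacDerivation_apply (F G : MvPolynomial (Fin 2) ℂ) :
    jacDerivation F G = jacDet F G := by
  simp [jacDerivation, jacDet]

/-- The Leibniz rule for finite products. -/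
theorem derivation_finset_prod {ι k A : Type*} [DecidableEq ι] [CommRing k] [CommRing A]
    [Algebra k A] (D : Derivation k A A) (s : Finset ι) (f : ι → A) :
    D (∏ i ∈ s, f i) = ∑ i ∈ s, (∏ l ∈ s.erase i, f l) * D (f i) := by
  induction s using Finset.induction_on with
  | empty => simp
  | insert a s ha ih =>
    rw [Finset.prod_insert ha, D.leibniz, ih, Finset.sum_insert ha, Finset.erase_insert ha,
      smul_eq_mul, smul_eq_mul, Finset.mul_sum, add_comm]
    congr 1
    refine Finset.sum_congr rfl fun i hi => ?_
    have hne : a ≠ i := fun h => ha (h ▸ hi)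
    rw [Finset.erase_insert_of_ne hne,
      Finset.prod_insert fun h => ha (Finset.mem_of_mem_erase h), mul_assoc]

theorem jacDet_Rpow (R : ℕ → MvPolynomial (Fin 2) ℂ) (F : MvPolynomial (Fin 2) ℂ)
    (a : ℕ+ →₀ ℕ) :
    jacDet F (Rpow R a) =
      ∑ i ∈ a.support, (a i : MvPolynomial (Fin 2) ℂ) * Rpow R (a - Finsupp.single i 1) *
        jacDet F (R i) := by
  classical
  simp only [← jacDerivation_apply]
  rw [Rpow, Finsupp.prod, derivation_finset_prod]
  refine Finset.sum_congr rfl fun i hi => ?_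
  have hR : Rpow R (a - Finsupp.single i 1) =
      R i ^ (a i - 1) * ∏ l ∈ a.support.erase i, R l ^ a l := by
    rw [Rpow, Finsupp.prod_of_support_subset _ (s := a.support) _ _ (by simp),
      ← Finset.mul_prod_erase _ _ hi]
    · simp only [Finsupp.tsub_apply, Finsupp.single_eq_same]
      congr 1
      refine Finset.prod_congr rfl fun l hl => ?_
      rw [Finsupp.single_eq_of_ne (Finset.ne_of_mem_erase hl), tsub_zero]
    · intro l hl
      simp only [Finsupp.mem_support_iff, Finsupp.tsub_apply] at hl ⊢
      omega
  rw [hR, Derivation.leibniz_pow, nsmul_eq_mul, smul_eq_mul]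
  ring

/-- The summand indexed by a multi-index `α` and a position `i`, obtained by expanding
`D(R_{N - σ(α)}, R^α)` with the Leibniz rule. -/
noncomputable def jacTerm (N : ℕ) (g : FF) (R : ℕ → MvPolynomial (Fin 2) ℂ) (t : ℚ) (e s : ℤ)
    (a : ℕ+ →₀ ℕ) (i : ℕ+) : FF :=
  ((mcoeff t a * (a i : ℚ) : ℚ) : FF) * g ^ (e - s * (msize a : ℤ)) *
    algebraMap (MvPolynomial (Fin 2) ℂ) FF
      (Rpow R (a - Finsupp.single i 1) * jacDet (R (N - ssize a)) (R i))

theorem jacTerm_add_single (N : ℕ) (g : FF) (R : ℕ → MvPolynomial (Fin 2) ℂ) (t : ℚ) (e s : ℤ)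
    (b : ℕ+ →₀ ℕ) (i m : ℕ+) (h : ssize b + i + m = N) :
    jacTerm N g R t e s (b + Finsupp.single i 1) i =
      ((Polynomial.eval t (descPochhammer ℚ (msize b + 1)) / (gfact b : ℚ) : ℚ) : FF) *
        g ^ (e - s * ((msize b + 1 : ℕ) : ℤ)) *
        algebraMap (MvPolynomial (Fin 2) ℂ) FF (Rpow R b * jacDet (R m) (R i)) := by
  have hm : N - (ssize b + i) = (m : ℕ) := by omega
  rw [jacTerm, mcoeff_add_single_mul, msize_add_single, ssize_add_single, hm,
    add_tsub_cancel_right]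

/-- The contributions `(β + e_i, i)` and `(β + e_m, m)` cancel when `σ(β) + i + m = N`. -/
theorem jacTerm_add_jacTerm (N : ℕ) (g : FF) (R : ℕ → MvPolynomial (Fin 2) ℂ) (t : ℚ)
    (e s : ℤ) (b : ℕ+ →₀ ℕ) (i m : ℕ+) (h : ssize b + i + m = N) :
    jacTerm N g R t e s (b + Finsupp.single i 1) i +
      jacTerm N g R t e s (b + Finsupp.single m 1) m = 0 := by
  rw [jacTerm_add_single N g R t e s b i m h, jacTerm_add_single N g R t e s b m i (by omega),
    jacDet_swap (R m) (R i), mul_neg, map_neg]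
  ring

theorem sum_jacTerm (N : ℕ) (g : FF) (R : ℕ → MvPolynomial (Fin 2) ℂ) (t : ℚ) (e s : ℤ) :
    ∑ x ∈ (finite_ssize_lt N).toFinset.sigma fun a => a.support,
      jacTerm N g R t e s x.1 x.2 = 0 := by
  have key : ∀ x ∈ (finite_ssize_lt N).toFinset.sigma fun a : ℕ+ →₀ ℕ => a.support,
      ∃ (b : ℕ+ →₀ ℕ) (m : ℕ+), x.1 = b + Finsupp.single x.2 1 ∧ ssize b + x.2 + m = N ∧
        x.1 - Finsupp.single x.2 1 = b ∧ (N - ssize x.1).toPNat' = m := by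
    rintro ⟨a, i⟩ hx
    simp only [Finset.mem_sigma, Set.Finite.mem_toFinset, Set.mem_ofPred_eq,
      Finsupp.mem_support_iff] at hx
    have ha : a = (a - Finsupp.single i 1) + Finsupp.single i 1 := by
      rw [tsub_add_cancel_of_le]
      rw [Finsupp.single_le_iff]
      omega
    refine ⟨_, _, ha, ?_, rfl, rfl⟩
    dsimp only
    rw [← ssize_add_single, ← ha, Nat.toPNat'_coe, if_pos (by omega)]
    omega
  refine Finset.sum_involution
    (fun x _ => ⟨x.1 - Finsupp.single x.2 1 + Finsupp.single (N - ssize x.1).toPNat' 1,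
      (N - ssize x.1).toPNat'⟩) ?_ ?_ ?_ ?_
  · intro x hx
    obtain ⟨b, m, h1, h2, h3, h4⟩ := key x hx
    simp only [h3, h4]
    rw [h1]
    exact jacTerm_add_jacTerm N g R t e s b x.2 m h2
  · intro x hx hne heq
    obtain ⟨b, m, h1, h2, h3, h4⟩ := key x hx
    refine hne ?_
    have hm : m = x.2 := by rw [← h4]; exact congrArg Sigma.snd heq
    rw [h1, jacTerm_add_single N g R t e s b x.2 m h2, hm, jacDet_self]
    simp
  · intro x hx
    obtain ⟨b, m, h1, h2, h3, h4⟩ := key x hx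
    have := x.2.pos
    simp only [h3, h4, Finset.mem_sigma, Set.Finite.mem_toFinset, Set.mem_ofPred_eq,
      ssize_add_single, Finsupp.mem_support_iff]
    refine ⟨by omega, by simp⟩
  · intro x hx
    obtain ⟨b, m, h1, h2, h3, h4⟩ := key x hx
    have h5 : (N - ssize (b + Finsupp.single m 1)).toPNat' = x.2 := by
      rw [ssize_add_single, show N - (ssize b + m) = (x.2 : ℕ) by omega, PNat.coe_toPNat']
    simp only [h3, h4, h5, add_tsub_cancel_right]
    rw [← h1]

theorem sum_mcoeff_mul_jacDet_Rpow (N : ℕ) (g : FF) (R : ℕ → MvPolynomial (Fin 2) ℂ) (t : ℚ)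
    (e s : ℤ) :
    ∑ a ∈ (finite_ssize_lt N).toFinset,
      ((mcoeff t a : ℚ) : FF) * g ^ (e - s * (msize a : ℤ)) *
        algebraMap (MvPolynomial (Fin 2) ℂ) FF (jacDet (R (N - ssize a)) (Rpow R a)) = 0 := by
  rw [← sum_jacTerm N g R t e s, Finset.sum_sigma]
  refine Finset.sum_congr rfl fun a _ => ?_
  rw [jacDet_Rpow, map_sum, Finset.mul_sum]
  refine Finset.sum_congr rfl fun i _ => ?_
  simp only [jacTerm, map_mul, map_natCast, Rat.cast_mul, Rat.cast_natCast]
  ring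

/-- Statement 1 of the paper:
`Σ_{j'=0}^{j-1} Σ_{r=0}^{j'} Σ_{σ(α)=j'-r} λ_r C(t_r,α) G^{s_r - s|α|} D(R_{j-j'}, R^α) = 0`
in the fraction field of `ℂ[x,y]`. -/
theorem statement1 (s j : ℕ) (hs : 1 ≤ s) (hj : 1 ≤ j)
    (G : MvPolynomial (Fin 2) ℂ) (hG : G ≠ 0)
    (R : ℕ → MvPolynomial (Fin 2) ℂ)
    (lam : ℕ → ℂ) (t : ℕ → ℚ) (sr : ℕ → ℤ)
    (hsr : ∀ r < j, (sr r : ℚ) = (s : ℚ) * t r) :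
    ∑ j' ∈ Finset.range j, ∑ r ∈ Finset.range (j' + 1),
      ∑ᶠ a ∈ {a : ℕ+ →₀ ℕ | ssize a = j' - r},
        algebraMap (MvPolynomial (Fin 2) ℂ) FF (C (lam r)) *
          ((mcoeff (t r) a : ℚ) : FF) *
          (algebraMap (MvPolynomial (Fin 2) ℂ) FF G) ^ (sr r - (s : ℤ) * (msize a : ℤ)) *
          algebraMap (MvPolynomial (Fin 2) ℂ) FF (jacDet (R (j - j')) (Rpow R a))
      = 0 := by
  have hflip := Finset.sum_range_diag_flip j fun r k =>
    ∑ᶠ a ∈ {a : ℕ+ →₀ ℕ | ssize a = k},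
      algebraMap (MvPolynomial (Fin 2) ℂ) FF (C (lam r)) *
        ((mcoeff (t r) a : ℚ) : FF) *
        (algebraMap (MvPolynomial (Fin 2) ℂ) FF G) ^ (sr r - (s : ℤ) * (msize a : ℤ)) *
        algebraMap (MvPolynomial (Fin 2) ℂ) FF (jacDet (R (j - r - k)) (Rpow R a))
  refine Eq.trans (Finset.sum_congr rfl fun j' _ => Finset.sum_congr rfl fun r hr => ?_)
    (hflip.trans (Finset.sum_eq_zero fun r _ => ?_))
  · rw [Finset.mem_range] at hr
    rw [show j - r - (j' - r) = j - j' by omega]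
  · rw [sum_finsum_ssize (j - r)]
    simp only [mul_assoc]
    rw [← Finset.mul_sum]
    simp only [← mul_assoc]
    rw [sum_mcoeff_mul_jacDet_Rpow, mul_zero]
end
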